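/- If there exists a mechanism 𝓜 = ((M_i,τ_i)_{i∈𝓘}, g) with arbitrary (possibly infinite) nonempty message sets such that for every state θ ∈ Θ the game Γ(𝓜,θ) has a pure-strategy Nash equilibrium, and every pure-strategy Nash equilibrium m of Γ(𝓜,θ) satisfies g(m) = f(θ) and τ_i(m) = 0 for every agent i, then f satisfies Maskin monotonicity. -/

import Mathlib

/-!
STATEMENT 1: If there exists a mechanism (with arbitrary, possibly infinite, nonempty
message sets) such that for every state θ the game Γ(𝓜,θ) has a pure-strategy Nash
equilibrium, and every pure-strategy Nash equilibrium m of Γ(𝓜,θ) satisfies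
g(m) = f(θ) and τ_i(m) = 0 for every agent i, then f satisfies Maskin monotonicity.
-/

open scoped BigOperators Classical

noncomputable section

/-- The outcome space `X = Δ(A) × ℝ^I`. -/
abbrev Outc (A : Type) (I : ℕ) : Type := PMF A × (Fin I → ℝ)

/-- Expected utility of a countably supported lottery under Bernoulli utility `w`. -/
def eu {A : Type} (w : A → ℝ) (ℓ : PMF A) : ℝ := ∑' a, (ℓ a).toReal * w a

/-- Agent `i`'s quasilinear utility `ũ_i(x,θ) = v_i(ℓ,θ) + t_i`. -/
def uT {A Θ : Type} {I : ℕ} (w : Fin I → A → Θ → ℝ) (i : Fin I) (x : Outc A I) (θ : Θ) : ℝ :=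
  eu (fun a => w i a θ) x.1 + x.2 i

/-- Maskin monotonicity of an SCF `f : Θ → X`. -/
def MaskinMonotone {A Θ : Type} {I : ℕ} (w : Fin I → A → Θ → ℝ) (f : Θ → Outc A I) : Prop :=
  ∀ θ' θ : Θ, f θ' ≠ f θ →
    ∃ (i : Fin I) (x : Outc A I),
      uT w i x θ' ≤ uT w i (f θ') θ' ∧ uT w i (f θ') θ < uT w i x θ

/-- A mechanism with arbitrary nonempty message sets. -/
structure Mech (A : Type) (I : ℕ) where
  M : Fin I → Type
  nonemptyM : ∀ i, Nonempty (M i)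
  g : (∀ i, M i) → Outc A I
  τ : Fin I → (∀ i, M i) → ℝ

attribute [instance] Mech.nonemptyM

variable {A Θ : Type} {I : ℕ}

/-- Agent `i`'s payoff in the complete-information game `Γ(𝓜,θ)`. -/
def payoff (w : Fin I → A → Θ → ℝ) (𝓜 : Mech A I) (θ : Θ) (i : Fin I)
    (m : ∀ j, 𝓜.M j) : ℝ :=
  uT w i (𝓜.g m) θ + 𝓜.τ i m

/-- Pure-strategy Nash equilibrium of `Γ(𝓜,θ)`. -/
def IsPureNE (w : Fin I → A → Θ → ℝ) (𝓜 : Mech A I) (θ : Θ)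
    (m : ∀ j, 𝓜.M j) : Prop :=
  ∀ (i : Fin I) (mi' : 𝓜.M i),
    payoff w 𝓜 θ i (Function.update m i mi') ≤ payoff w 𝓜 θ i m

/-- **Necessity of Maskin monotonicity**: if some (possibly infinite) mechanism
implements `f` in pure-strategy Nash equilibria, then `f` is Maskin monotonic. -/
theorem maskinMonotone_of_pure_implementable
    [Fintype Θ] [Nonempty A] (hI : 2 ≤ I)
    (w : Fin I → A → Θ → ℝ) (B : ℝ) (hB : ∀ i a θ, |w i a θ| ≤ B)
    (f : Θ → Outc A I)
    (himp : ∃ 𝓜 : Mech A I, ∀ θ : Θ,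
      (∃ m, IsPureNE w 𝓜 θ m) ∧
      ∀ m, IsPureNE w 𝓜 θ m → 𝓜.g m = f θ ∧ ∀ i, 𝓜.τ i m = 0) :
    MaskinMonotone w f := by
  obtain ⟨𝓜, h𝓜⟩ := himp
  intro θ' θ hne
  obtain ⟨m, hm⟩ := (h𝓜 θ').1
  obtain ⟨hg, hτ⟩ := (h𝓜 θ').2 m hm
  have hnot : ¬ IsPureNE w 𝓜 θ m := fun h => hne (hg.symm.trans ((h𝓜 θ).2 m h).1)
  unfold IsPureNE at hnot
  push Not at hnot
  obtain ⟨i, mi', hdev⟩ := hnot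
  have hstay := hm i mi'
  set m' := Function.update m i mi'
  have hval : ∀ η, uT w i ((𝓜.g m').1, fun j => (𝓜.g m').2 j + 𝓜.τ j m') η
      = payoff w 𝓜 η i m' := fun η => by
    simp only [payoff, uT]
    ring
  have heq : ∀ η, payoff w 𝓜 η i m = uT w i (f θ') η := fun η => by
    simp only [payoff, hg, hτ, add_zero]
  refine ⟨i, ((𝓜.g m').1, fun j => (𝓜.g m').2 j + 𝓜.τ j m'), ?_, ?_⟩
  · rw [hval, ← heq]
    exact hstay
  · rw [hval, ← heq]
    exact hdev

end
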